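/- arXiv:2404.10113 — 5 statements merged into one kernel-verified Lean document; each statement's English description precedes it below -/
import Mathlib

section
/- Let g : ℝ⁴ → (4×4 real symmetric matrices) be smooth with g(x) invertible for all x, let Γ^a_{bc} = (1/2) Σ_d (g⁻¹)^{ad}(∂_b g_{dc} + ∂_c g_{bd} − ∂_d g_{bc}) be its Levi-Civita connection coefficients, and let h : ℝ⁴ → (4×4 real symmetric matrices) be differentiable. Let ℓ : ℝ⁴ → ℝ⁴ be differentiable and suppose: (i) the gauge condition Σ_c ℓ^c h_{cd} = 0 holds everywhere for all d, and (ii) ℓ is geodesic for g, i.e. there is κ : ℝ⁴ → ℝ with Σ_a ℓ^a (∂_a ℓ^b + Σ_c Γ^b_{ac} ℓ^c) = κ ℓ^b everywhere for all b. Define the linearized connection Ċ^a_{bc} = (1/2) Σ_d (g⁻¹)^{ad} [ (∇̊_b h)_{cd} + (∇̊_c h)_{bd} − (∇̊_d h)_{bc} ], where (∇̊_a h)_{cd} = ∂_a h_{cd} − Σ_e Γ^e_{ac} h_{ed} − Σ_e Γ^e_{ad} h_{ce}. Then Σ_{a,c} ℓ^a Ċ^b_{ac} ℓ^c = 0 everywhere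 for all b; consequently the perturbed covariant acceleration of ℓ equals κ ℓ^b to first order, with unchanged inaffinity κ. -/
open scoped BigOperators

/-- Partial derivative of a scalar field on `ℝ⁴` in the `a`-th coordinate direction. -/
noncomputable def pderiv4 (f : (Fin 4 → ℝ) → ℝ) (x : Fin 4 → ℝ) (a : Fin 4) : ℝ :=
  fderiv ℝ f x (Pi.single a 1)

/-- Levi-Civita connection coefficients `Γ^a_{bc}` of a metric field `g` on `ℝ⁴`:
`Γ^a_{bc} = (1/2) Σ_d g^{ad} (∂_b g_{dc} + ∂_c g_{bd} − ∂_d g_{bc})`, with `g⁻¹`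
the pointwise matrix inverse. -/
noncomputable def Christoffel (g : (Fin 4 → ℝ) → Matrix (Fin 4) (Fin 4) ℝ)
    (x : Fin 4 → ℝ) (a b c : Fin 4) : ℝ :=
  (1 / 2) * ∑ d, (g x)⁻¹ a d *
    (pderiv4 (fun y => g y d c) x b + pderiv4 (fun y => g y b d) x c
      - pderiv4 (fun y => g y b c) x d)

/-- Background covariant derivative of a symmetric rank-2 field:
`(∇̊_a h)_{cd} = ∂_a h_{cd} − Σ_e Γ^e_{ac} h_{ed} − Σ_e Γ^e_{ad} h_{ce}`. -/
noncomputable def covDh (g h : (Fin 4 → ℝ) → Matrix (Fin 4) (Fin 4) ℝ)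
    (x : Fin 4 → ℝ) (a c d : Fin 4) : ℝ :=
  pderiv4 (fun y => h y c d) x a
    - ∑ e, Christoffel g x e a c * h x e d
    - ∑ e, Christoffel g x e a d * h x c e

/-- Linearized difference-of-connections tensor
`Ċ^a_{bc} = (1/2) Σ_d g^{ad} [ (∇̊_b h)_{cd} + (∇̊_c h)_{bd} − (∇̊_d h)_{bc} ]`. -/
noncomputable def Cdot (g h : (Fin 4 → ℝ) → Matrix (Fin 4) (Fin 4) ℝ)
    (x : Fin 4 → ℝ) (a b c : Fin 4) : ℝ :=
  (1 / 2) * ∑ d, (g x)⁻¹ a d *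
    (covDh g h x b c d + covDh g h x c b d - covDh g h x d b c)

/-- The product rule for the contraction of a vector field with a rank-2 field,
applied to a vanishing contraction. -/
lemma sum_pderiv4_contraction_eq_zero
    {h : (Fin 4 → ℝ) → Matrix (Fin 4) (Fin 4) ℝ} {ℓ : (Fin 4 → ℝ) → Fin 4 → ℝ}
    (h_diff : ∀ c d : Fin 4, Differentiable ℝ (fun x => h x c d))
    (ℓ_diff : ∀ c : Fin 4, Differentiable ℝ (fun x => ℓ x c))
    (gauge : ∀ (x : Fin 4 → ℝ) (d : Fin 4), ∑ c, ℓ x c * h x c d = 0)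
    (x : Fin 4 → ℝ) (a d : Fin 4) :
    ∑ c, (ℓ x c * pderiv4 (fun y => h y c d) x a
      + h x c d * pderiv4 (fun y => ℓ y c) x a) = 0 := by
  have hsum : HasFDerivAt (fun y => ∑ c, ℓ y c * h y c d)
      (∑ c, (ℓ x c • fderiv ℝ (fun y => h y c d) x
        + h x c d • fderiv ℝ (fun y => ℓ y c) x)) x :=
    HasFDerivAt.fun_sum fun c _ => (ℓ_diff c x).hasFDerivAt.mul (h_diff c d x).hasFDerivAt
  have hzero : HasFDerivAt (fun y => ∑ c, ℓ y c * h y c d)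
      (0 : (Fin 4 → ℝ) →L[ℝ] ℝ) x := by
    simpa only [gauge] using hasFDerivAt_const (0 : ℝ) x
  simpa [pderiv4] using congrArg (fun L => L (Pi.single a 1)) (hsum.unique hzero)

/-- If `ℓ` is geodesic and annihilates `h`, then `ℓ^a ℓ^c (∇̊_a h)_{cd} = 0`. -/
lemma sum_covDh_geodesic_eq_zero
    {g h : (Fin 4 → ℝ) → Matrix (Fin 4) (Fin 4) ℝ} {ℓ : (Fin 4 → ℝ) → Fin 4 → ℝ}
    {κ : (Fin 4 → ℝ) → ℝ}
    (h_diff : ∀ c d : Fin 4, Differentiable ℝ (fun x => h x c d))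
    (ℓ_diff : ∀ c : Fin 4, Differentiable ℝ (fun x => ℓ x c))
    (gauge : ∀ (x : Fin 4 → ℝ) (d : Fin 4), ∑ c, ℓ x c * h x c d = 0)
    (geodesic : ∀ (x : Fin 4 → ℝ) (b : Fin 4),
      ∑ a, ℓ x a * (pderiv4 (fun y => ℓ y b) x a
        + ∑ c, Christoffel g x b a c * ℓ x c) = κ x * ℓ x b)
    (x : Fin 4 → ℝ) (d : Fin 4) :
    ∑ a, ∑ c, ℓ x a * covDh g h x a c d * ℓ x c = 0 := by
  have hD : ∑ a, ℓ x a * ∑ c, (ℓ x c * pderiv4 (fun y => h y c d) x a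
      + h x c d * pderiv4 (fun y => ℓ y c) x a) = 0 := by
    simp [sum_pderiv4_contraction_eq_zero h_diff ℓ_diff gauge]
  have hgeo : ∑ e, (∑ a, ℓ x a * (pderiv4 (fun y => ℓ y e) x a
      + ∑ c, Christoffel g x e a c * ℓ x c)) * h x e d
      = κ x * ∑ e, ℓ x e * h x e d := by
    simp_rw [geodesic, Finset.mul_sum, mul_assoc]
  have hG : ∑ a, ℓ x a * ∑ e, Christoffel g x e a d * ∑ c, ℓ x c * h x c e = 0 := by
    simp [gauge]
  rw [gauge, mul_zero] at hgeo
  simp only [covDh, Fin.sum_univ_four] at hD hgeo hG ⊢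
  linear_combination hD - hgeo - hG

/-- If `ℓ` annihilates the symmetric field `h`, then `ℓ^a ℓ^c (∇̊_d h)_{ac} = 0`. -/
lemma sum_covDh_gauge_eq_zero
    {g h : (Fin 4 → ℝ) → Matrix (Fin 4) (Fin 4) ℝ} {ℓ : (Fin 4 → ℝ) → Fin 4 → ℝ}
    (h_symm : ∀ x, (h x).IsSymm)
    (h_diff : ∀ c d : Fin 4, Differentiable ℝ (fun x => h x c d))
    (ℓ_diff : ∀ c : Fin 4, Differentiable ℝ (fun x => ℓ x c))
    (gauge : ∀ (x : Fin 4 → ℝ) (d : Fin 4), ∑ c, ℓ x c * h x c d = 0)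
    (x : Fin 4 → ℝ) (d : Fin 4) :
    ∑ a, ∑ c, ℓ x a * covDh g h x d a c * ℓ x c = 0 := by
  have gauge' (a : Fin 4) : ∑ c, h x a c * ℓ x c = 0 := by
    simp_rw [← gauge x a, (h_symm x).apply, mul_comm (ℓ x _)]
  have hD : ∑ c, (∑ a, (ℓ x a * pderiv4 (fun y => h y a c) x d
      + h x a c * pderiv4 (fun y => ℓ y a) x d)) * ℓ x c = 0 := by
    simp [sum_pderiv4_contraction_eq_zero h_diff ℓ_diff gauge]
  have hDℓ : ∑ a, pderiv4 (fun y => ℓ y a) x d * ∑ c, h x a c * ℓ x c = 0 := by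
    simp [gauge']
  have hG₁ : ∑ a, ℓ x a * ∑ e, Christoffel g x e d a * ∑ c, h x e c * ℓ x c = 0 := by
    simp [gauge']
  have hG₂ : ∑ c, ℓ x c * ∑ e, Christoffel g x e d c * ∑ a, ℓ x a * h x a e = 0 := by
    simp [gauge]
  simp only [covDh, Fin.sum_univ_four] at hD hDℓ hG₁ hG₂ ⊢
  linear_combination hD - hDℓ - hG₁ - hG₂

/-- For a smooth invertible symmetric metric field `g` on `ℝ⁴` with
Levi-Civita coefficients `Γ`, a differentiable symmetric perturbation `h` satisfying
the radiation-gauge condition `Σ_c ℓ^c h_{cd} = 0`, and a differentiable vector field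
`ℓ` that is geodesic for `g` with inaffinity `κ` (`Σ_a ℓ^a ∇̊_a ℓ^b = κ ℓ^b`), the
linearized connection satisfies `Σ_{a,c} ℓ^a Ċ^b_{ac} ℓ^c = 0`; consequently the
perturbed covariant acceleration of `ℓ` still equals `κ ℓ^b` to first order, with
unchanged inaffinity `κ`. -/
theorem radiation_gauge_geodesic_preserved
    (g h : (Fin 4 → ℝ) → Matrix (Fin 4) (Fin 4) ℝ)
    (ℓ : (Fin 4 → ℝ) → Fin 4 → ℝ)
    (κ : (Fin 4 → ℝ) → ℝ)
    (g_smooth : ∀ a b : Fin 4, ContDiff ℝ (⊤ : ℕ∞) (fun x => g x a b))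
    (g_symm : ∀ x, (g x).IsSymm)
    (g_inv : ∀ x, IsUnit (g x).det)
    (h_symm : ∀ x, (h x).IsSymm)
    (h_diff : ∀ c d : Fin 4, Differentiable ℝ (fun x => h x c d))
    (ℓ_diff : ∀ c : Fin 4, Differentiable ℝ (fun x => ℓ x c))
    (gauge : ∀ (x : Fin 4 → ℝ) (d : Fin 4), ∑ c, ℓ x c * h x c d = 0)
    (geodesic : ∀ (x : Fin 4 → ℝ) (b : Fin 4),
      ∑ a, ℓ x a * (pderiv4 (fun y => ℓ y b) x a
        + ∑ c, Christoffel g x b a c * ℓ x c) = κ x * ℓ x b) :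
    ∀ (x : Fin 4 → ℝ) (b : Fin 4),
      (∑ a, ∑ c, ℓ x a * Cdot g h x b a c * ℓ x c = 0) ∧
      (∀ ε : ℝ,
        ∑ a, ℓ x a * (pderiv4 (fun y => ℓ y b) x a
          + ∑ c, (Christoffel g x b a c + ε * Cdot g h x b a c) * ℓ x c)
        = κ x * ℓ x b) := by
  intro x b
  have hC : ∑ a, ∑ c, ℓ x a * Cdot g h x b a c * ℓ x c = 0 := by
    have hcov (d : Fin 4) : ∑ a, ∑ c, ℓ x a *
        (covDh g h x a c d + covDh g h x c a d - covDh g h x d a c) * ℓ x c = 0 := by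
      have h₁ := sum_covDh_geodesic_eq_zero h_diff ℓ_diff gauge geodesic x d
      have h₂ := sum_covDh_gauge_eq_zero (g := g) h_symm h_diff ℓ_diff gauge x d
      simp only [Fin.sum_univ_four] at h₁ h₂ ⊢
      linear_combination 2 * h₁ - h₂
    calc ∑ a, ∑ c, ℓ x a * Cdot g h x b a c * ℓ x c
        = (1 / 2) * ∑ d, (g x)⁻¹ b d * ∑ a, ∑ c, ℓ x a *
            (covDh g h x a c d + covDh g h x c a d - covDh g h x d a c) * ℓ x c := by
          simp only [Cdot, Fin.sum_univ_four]
          ring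
      _ = 0 := by simp [hcov]
  refine ⟨hC, fun ε => ?_⟩
  rw [← geodesic x b]
  simp only [Fin.sum_univ_four] at hC ⊢
  linear_combination ε * hC
end

section
/- For all (r, θ) with Σ ≠ 0, sin θ ≠ 0, and r² + a² ≠ 0, the Hartle–Hawking tetrad is a null tetrad for the Kerr metric: ℓᵀ g ℓ = 0, nᵀ g n = 0, ℓᵀ g n = −1, mᵀ g m = 0, mᵀ g m̄ = 1, ℓᵀ g m = 0, and nᵀ g m = 0 (where the complex vector m is contracted with the real matrix g entrywise and m̄ is its complex conjugate). -/
open scoped BigOperators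
open Matrix

/-- `Δ = r² − 2Mr + a²` for the Kerr metric. -/
noncomputable def kerrΔ (M a r : ℝ) : ℝ := r ^ 2 - 2 * M * r + a ^ 2

/-- `Σ = r² + a² cos²θ` for the Kerr metric. -/
noncomputable def kerrSigma (a r θ : ℝ) : ℝ := r ^ 2 + a ^ 2 * Real.cos θ ^ 2

/-- The Kerr metric in ingoing coordinates `(v, r, θ, φ)` (indices `0,1,2,3`),
determined by the line element
`ds² = −(1 − 2Mr/Σ)(dv − a sin²θ dφ)² + 2(dv − a sin²θ dφ)(dr − a sin²θ dφ)
      + Σ(dθ² + sin²θ dφ²)`. -/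
noncomputable def kerrMetric (M a r θ : ℝ) : Matrix (Fin 4) (Fin 4) ℝ :=
  fun i j =>
    let e1 : Fin 4 → ℝ := ![1, 0, 0, -a * Real.sin θ ^ 2]  -- dv − a sin²θ dφ
    let e2 : Fin 4 → ℝ := ![0, 1, 0, -a * Real.sin θ ^ 2]  -- dr − a sin²θ dφ
    let e3 : Fin 4 → ℝ := ![0, 0, 1, 0]                    -- dθ
    let e4 : Fin 4 → ℝ := ![0, 0, 0, 1]                    -- dφ
    (-(1 - 2 * M * r / kerrSigma a r θ) * e1 i * e1 j
      + (e1 i * e2 j + e2 i * e1 j)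
      + kerrSigma a r θ * e3 i * e3 j
      + kerrSigma a r θ * Real.sin θ ^ 2 * e4 i * e4 j)

/-- The `ℓ` vector of the Hartle–Hawking tetrad:
`ℓ = (1, Δ/(2(r²+a²)), 0, a/(r²+a²))`. -/
noncomputable def ellHH (M a r : ℝ) : Fin 4 → ℝ :=
  ![1, kerrΔ M a r / (2 * (r ^ 2 + a ^ 2)), 0, a / (r ^ 2 + a ^ 2)]

/-- The `n` vector of the Hartle–Hawking tetrad: `n = (0, −(r²+a²)/Σ, 0, 0)`. -/
noncomputable def nHH (a r θ : ℝ) : Fin 4 → ℝ :=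
  ![0, -(r ^ 2 + a ^ 2) / kerrSigma a r θ, 0, 0]

/-- The complex `m` vector of the Hartle–Hawking tetrad:
`m = (1/(√2 (r + i a cos θ))) (i a sin θ, 0, 1, i/sin θ)`. -/
noncomputable def mHH (a r θ : ℝ) : Fin 4 → ℂ :=
  fun i => (1 / (Real.sqrt 2 * ((r : ℂ) + Complex.I * (a : ℂ) * (Real.cos θ : ℂ)))) *
    ![Complex.I * (a : ℂ) * (Real.sin θ : ℂ), 0, 1, Complex.I / (Real.sin θ : ℂ)] i

/-- The real Kerr bilinear form, factored through the coframe `dv − a sin²θ dφ`, `dr − a sin²θ dφ`,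
`dθ`, `dφ`. -/
lemma sum_kerrMetric_real (M a r θ : ℝ) (u w : Fin 4 → ℝ) :
    ∑ i, ∑ j, u i * kerrMetric M a r θ i j * w j =
      -(1 - 2 * M * r / kerrSigma a r θ) * (u 0 - a * Real.sin θ ^ 2 * u 3) *
          (w 0 - a * Real.sin θ ^ 2 * w 3)
        + ((u 0 - a * Real.sin θ ^ 2 * u 3) * (w 1 - a * Real.sin θ ^ 2 * w 3)
          + (u 1 - a * Real.sin θ ^ 2 * u 3) * (w 0 - a * Real.sin θ ^ 2 * w 3))
        + kerrSigma a r θ * (u 2 * w 2 + Real.sin θ ^ 2 * u 3 * w 3) := by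
  simp [Fin.sum_univ_four, kerrMetric]
  ring

/-- The complex-bilinear extension of the Kerr form, factored through the same coframe. -/
lemma sum_kerrMetric_complex (M a r θ : ℝ) (u w : Fin 4 → ℂ) :
    ∑ i, ∑ j, u i * (kerrMetric M a r θ i j : ℂ) * w j =
      -(1 - 2 * M * r / kerrSigma a r θ) * (u 0 - a * (Real.sin θ : ℂ) ^ 2 * u 3) *
          (w 0 - a * (Real.sin θ : ℂ) ^ 2 * w 3)
        + ((u 0 - a * (Real.sin θ : ℂ) ^ 2 * u 3) * (w 1 - a * (Real.sin θ : ℂ) ^ 2 * w 3)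
          + (u 1 - a * (Real.sin θ : ℂ) ^ 2 * u 3) * (w 0 - a * (Real.sin θ : ℂ) ^ 2 * w 3))
        + kerrSigma a r θ * (u 2 * w 2 + (Real.sin θ : ℂ) ^ 2 * u 3 * w 3) := by
  simp [Fin.sum_univ_four, kerrMetric, -Complex.ofReal_sin]
  ring

/-- `dv − a sin²θ dφ` takes the value `Σ/(r²+a²)` on `ℓ`. -/
lemma ellHH_coframe {a r : ℝ} (M θ : ℝ) (hra : r ^ 2 + a ^ 2 ≠ 0) :
    ellHH M a r 0 - a * Real.sin θ ^ 2 * ellHH M a r 3 =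
      kerrSigma a r θ / (r ^ 2 + a ^ 2) := by
  simp only [ellHH, kerrSigma, Matrix.cons_val, Real.sin_sq]
  field_simp
  ring

/-- `dv − a sin²θ dφ` annihilates `m`. -/
lemma mHH_coframe (a r : ℝ) {θ : ℝ} (hs : Real.sin θ ≠ 0) :
    mHH a r θ 0 - a * (Real.sin θ : ℂ) ^ 2 * mHH a r θ 3 = 0 := by
  have hs' : (Real.sin θ : ℂ) ≠ 0 := Complex.ofReal_ne_zero.mpr hs
  simp only [mHH, Matrix.cons_val]
  generalize 1 / ((Real.sqrt 2 : ℂ) * ((r : ℂ) + Complex.I * a * Real.cos θ)) = c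
  field_simp
  ring

/-- `sin θ · dφ` takes the value `i · dθ` on `m`. -/
lemma sin_mul_mHH_three (a r : ℝ) {θ : ℝ} (hs : Real.sin θ ≠ 0) :
    (Real.sin θ : ℂ) * mHH a r θ 3 = Complex.I * mHH a r θ 2 := by
  have hs' : (Real.sin θ : ℂ) ≠ 0 := Complex.ofReal_ne_zero.mpr hs
  simp only [mHH, Matrix.cons_val]
  field_simp

/-- `|m^θ|² = 1/(2Σ)`. -/
lemma mHH_two_mul_conj (a r θ : ℝ) :
    mHH a r θ 2 * (starRingEnd ℂ) (mHH a r θ 2) = 1 / (2 * kerrSigma a r θ : ℝ) := by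
  have h : (Complex.normSq ((r : ℂ) + Complex.I * a * Real.cos θ)) = kerrSigma a r θ := by
    simp [Complex.normSq_apply, kerrSigma, -Complex.ofReal_cos]
    ring
  rw [Complex.mul_conj]
  simp only [mHH, Matrix.cons_val, mul_one, map_div₀, map_one, map_mul, h,
    Complex.normSq_ofReal]
  norm_num

/-- For all `(r, θ)` with `Σ ≠ 0`, `sin θ ≠ 0`, `r² + a² ≠ 0`, the
Hartle–Hawking tetrad is a null tetrad for the Kerr metric: `ℓᵀgℓ = 0`, `nᵀgn = 0`,
`ℓᵀgn = −1`, `mᵀgm = 0`, `mᵀgm̄ = 1`, `ℓᵀgm = 0`, `nᵀgm = 0`. -/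
theorem hartleHawking_is_null_tetrad (M a r θ : ℝ)
    (hSig : kerrSigma a r θ ≠ 0) (hs : Real.sin θ ≠ 0) (hra : r ^ 2 + a ^ 2 ≠ 0) :
    (∑ i, ∑ j, ellHH M a r i * kerrMetric M a r θ i j * ellHH M a r j = 0) ∧
    (∑ i, ∑ j, nHH a r θ i * kerrMetric M a r θ i j * nHH a r θ j = 0) ∧
    (∑ i, ∑ j, ellHH M a r i * kerrMetric M a r θ i j * nHH a r θ j = -1) ∧
    (∑ i, ∑ j, mHH a r θ i * (kerrMetric M a r θ i j : ℂ) * mHH a r θ j = 0) ∧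
    (∑ i, ∑ j, mHH a r θ i * (kerrMetric M a r θ i j : ℂ)
        * (starRingEnd ℂ) (mHH a r θ j) = 1) ∧
    (∑ i, ∑ j, (ellHH M a r i : ℂ) * (kerrMetric M a r θ i j : ℂ) * mHH a r θ j = 0) ∧
    (∑ i, ∑ j, (nHH a r θ i : ℂ) * (kerrMetric M a r θ i j : ℂ) * mHH a r θ j = 0) := by
  have hs2 : Real.sin θ ^ 2 = 1 - Real.cos θ ^ 2 := Real.sin_sq θ
  have hSigC : (kerrSigma a r θ : ℂ) ≠ 0 := Complex.ofReal_ne_zero.mpr hSig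
  have hraC : ((r : ℂ) ^ 2 + (a : ℂ) ^ 2) ≠ 0 := by exact_mod_cast hra
  have hm := mHH_coframe a r hs
  have hm3 := sin_mul_mHH_three a r hs
  have hm1 : mHH a r θ 1 = 0 := by simp [mHH]
  have hl := ellHH_coframe M θ hra
  have hlC : (ellHH M a r 0 : ℂ) - a * (Real.sin θ : ℂ) ^ 2 * (ellHH M a r 3 : ℂ) =
      kerrSigma a r θ / ((r : ℂ) ^ 2 + (a : ℂ) ^ 2) := by exact_mod_cast congrArg Complex.ofReal hl
  refine ⟨?_, ?_, ?_, ?_, ?_, ?_, ?_⟩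
  · rw [sum_kerrMetric_real, hl]
    simp only [ellHH, kerrΔ, Matrix.cons_val]
    field_simp
    simp only [kerrSigma, hs2]
    ring
  · rw [sum_kerrMetric_real]
    simp [nHH]
  · rw [sum_kerrMetric_real, hl]
    simp only [nHH, Matrix.cons_val]
    field_simp
    ring
  · rw [sum_kerrMetric_complex, hm]
    linear_combination (kerrSigma a r θ : ℂ) *
      ((Real.sin θ : ℂ) * mHH a r θ 3 + Complex.I * mHH a r θ 2) * hm3 +
      (kerrSigma a r θ : ℂ) * mHH a r θ 2 ^ 2 * Complex.I_sq
  · rw [sum_kerrMetric_complex (w := fun j => (starRingEnd ℂ) (mHH a r θ j)), hm]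
    have hmc := congrArg (starRingEnd ℂ) hm
    have hm3c := congrArg (starRingEnd ℂ) hm3
    have hmm := mHH_two_mul_conj a r θ
    simp only [map_sub, map_mul, map_pow, Complex.conj_ofReal, map_zero, Complex.conj_I]
      at hmc hm3c
    have hone : (kerrSigma a r θ : ℂ) * (1 / (2 * kerrSigma a r θ : ℝ)) = 1 / 2 := by
      push_cast
      field_simp
    rw [hmc]
    linear_combination (kerrSigma a r θ : ℂ) *
      ((Real.sin θ : ℂ) * (starRingEnd ℂ) (mHH a r θ 3) * hm3 +
        Complex.I * mHH a r θ 2 * hm3c -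
        mHH a r θ 2 * (starRingEnd ℂ) (mHH a r θ 2) * Complex.I_sq + 2 * hmm) + 2 * hone
  · rw [sum_kerrMetric_complex (u := fun i => (ellHH M a r i : ℂ)), hm, hlC, hm1]
    have h2 : (ellHH M a r 2 : ℂ) = 0 := by simp [ellHH]
    have h3 : (ellHH M a r 3 : ℂ) = a / ((r : ℂ) ^ 2 + (a : ℂ) ^ 2) := by simp [ellHH]
    rw [h2, h3]
    ring
  · rw [sum_kerrMetric_complex (u := fun i => (nHH a r θ i : ℂ)), hm]
    simp [nHH]
end

section
/- For all (r, θ) with Σ ≠ 0, sin θ ≠ 0, and r² + a² ≠ 0, the real 4×4 matrix G with entries G^{ab} = −ℓ^a n^b − n^a ℓ^b + m^a m̄^b + m̄^a m^b (built from the Hartle–Hawking tetrad; this combination is real) is the inverse of the Kerr metric matrix: g(r,θ) · G(r,θ) = 1 (the 4×4 identity matrix). -/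
open scoped BigOperators
open Matrix

open Complex in
theorem mHH_mul_conj_add_conj_mul (a r θ : ℝ) (i j : Fin 4) :
    mHH a r θ i * (starRingEnd ℂ) (mHH a r θ j) + (starRingEnd ℂ) (mHH a r θ i) * mHH a r θ j =
      (((![0, 0, 1, 0] : Fin 4 → ℝ) i * (![0, 0, 1, 0] : Fin 4 → ℝ) j +
        (![a * Real.sin θ, 0, 0, 1 / Real.sin θ] : Fin 4 → ℝ) i *
          (![a * Real.sin θ, 0, 0, 1 / Real.sin θ] : Fin 4 → ℝ) j) / kerrSigma a r θ : ℝ) := by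
  set p : Fin 4 → ℝ := ![0, 0, 1, 0] with hp
  set q : Fin 4 → ℝ := ![a * Real.sin θ, 0, 0, 1 / Real.sin θ] with hq
  set c : ℂ := 1 / (Real.sqrt 2 * ((r : ℂ) + I * (a : ℂ) * (Real.cos θ : ℂ))) with hc
  have hm (i : Fin 4) : mHH a r θ i = c * (p i + I * q i) := by
    refine congrArg (c * ·) ?_
    fin_cases i <;> simp [hp, hq, mul_assoc, div_eq_mul_inv]
  have hcc : c * (starRingEnd ℂ) c = ((1 / (2 * kerrSigma a r θ) : ℝ) : ℂ) := by
    have h : normSq ((r : ℂ) + I * (a : ℂ) * (Real.cos θ : ℂ)) = kerrSigma a r θ := by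
      rw [show (r : ℂ) + I * (a : ℂ) * (Real.cos θ : ℂ) = r + (a * Real.cos θ : ℝ) * I by
        push_cast; ring, normSq_add_mul_I, kerrSigma]
      ring
    rw [mul_conj, hc, map_div₀, map_mul, h, normSq_ofReal, map_one,
      Real.mul_self_sqrt zero_le_two]
  rw [hm, hm]
  simp only [map_mul, map_add, conj_ofReal, conj_I]
  calc _ = c * (starRingEnd ℂ) c * (2 * (p i * p j + q i * q j)) := by
        linear_combination (-2 * c * (starRingEnd ℂ) c * q i * q j) * I_sq
    _ = _ := by
        rw [hcc]
        push_cast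
        ring

/-- For all `(r, θ)` with `Σ ≠ 0`, `sin θ ≠ 0`, `r² + a² ≠ 0`, the
combination `G^{ab} = −ℓ^a n^b − n^a ℓ^b + m^a m̄^b + m̄^a m^b` built from the
Hartle–Hawking tetrad is real, and the real matrix `G` with those entries is the
inverse of the Kerr metric matrix: `g(r,θ) · G(r,θ) = 1`. -/
theorem hartleHawking_tetrad_assembles_inverse_metric (M a r θ : ℝ)
    (hSig : kerrSigma a r θ ≠ 0) (hs : Real.sin θ ≠ 0) (hra : r ^ 2 + a ^ 2 ≠ 0) :
    let Gc : Matrix (Fin 4) (Fin 4) ℂ := fun i j =>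
      -(ellHH M a r i : ℂ) * (nHH a r θ j : ℂ) - (nHH a r θ i : ℂ) * (ellHH M a r j : ℂ)
        + mHH a r θ i * (starRingEnd ℂ) (mHH a r θ j)
        + (starRingEnd ℂ) (mHH a r θ i) * mHH a r θ j
    let G : Matrix (Fin 4) (Fin 4) ℝ := fun i j => (Gc i j).re
    (∀ i j, (Gc i j).im = 0) ∧ kerrMetric M a r θ * G = 1 := by
  intro Gc G
  have hGc (i j : Fin 4) : Gc i j =
      ((-ellHH M a r i * nHH a r θ j - nHH a r θ i * ellHH M a r j +
        ((![0, 0, 1, 0] : Fin 4 → ℝ) i * (![0, 0, 1, 0] : Fin 4 → ℝ) j +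
        (![a * Real.sin θ, 0, 0, 1 / Real.sin θ] : Fin 4 → ℝ) i *
          (![a * Real.sin θ, 0, 0, 1 / Real.sin θ] : Fin 4 → ℝ) j) / kerrSigma a r θ : ℝ) : ℂ) := by
    rw [Complex.ofReal_add, ← mHH_mul_conj_add_conj_mul]
    push_cast
    exact add_assoc _ _ _
  refine ⟨fun i j => by rw [hGc, Complex.ofReal_im], ?_⟩
  have hG (i j : Fin 4) := (congrArg Complex.re (hGc i j)).trans (Complex.ofReal_re _)
  change ∀ i j, G i j = _ at hG
  have hcos : Real.cos θ ^ 2 = 1 - Real.sin θ ^ 2 := Real.cos_sq' θ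
  have hS : kerrSigma a r θ = r ^ 2 + a ^ 2 - a ^ 2 * Real.sin θ ^ 2 := by
    rw [kerrSigma, hcos]; ring
  ext i j
  simp only [Matrix.mul_apply, Fin.sum_univ_four, hG, kerrMetric, ellHH, nHH, kerrΔ]
  generalize kerrSigma a r θ = S at hS hSig
  fin_cases i <;> fin_cases j <;> simp <;> field_simp <;> subst hS <;> ring
end

section
/- Assume M > 0 and 0 ≤ a ≤ M, and set r₊ = M + √(M² − a²). Then the inaffinity function κ(r) = M(r² − a²)/(r² + a²)² of the Hartle–Hawking vector ℓ, evaluated at r = r₊, equals the surface gravity of the Kerr black hole: M(r₊² − a²)/(r₊² + a²)² = (r₊ − M)/(2Mr₊). -/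
open scoped BigOperators
open Matrix

/-- Assume `M > 0` and `0 ≤ a ≤ M`, and set `r₊ = M + √(M² − a²)`.
Then the inaffinity `κ(r) = M(r² − a²)/(r² + a²)²` of the Hartle–Hawking vector `ℓ`,
evaluated at `r = r₊`, equals the surface gravity of the Kerr black hole:
`M(r₊² − a²)/(r₊² + a²)² = (r₊ − M)/(2Mr₊)`. -/
theorem inaffinity_at_horizon_eq_surface_gravity (M a : ℝ)
    (hM : 0 < M) (ha0 : 0 ≤ a) (haM : a ≤ M) :
    let rp : ℝ := M + Real.sqrt (M ^ 2 - a ^ 2)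
    M * (rp ^ 2 - a ^ 2) / (rp ^ 2 + a ^ 2) ^ 2 = (rp - M) / (2 * M * rp) := by
  intro rp
  have hs : Real.sqrt (M ^ 2 - a ^ 2) ^ 2 = M ^ 2 - a ^ 2 := Real.sq_sqrt (by nlinarith)
  have hrp : 0 < rp := add_pos_of_pos_of_nonneg hM (Real.sqrt_nonneg _)
  have hΔ : rp ^ 2 + a ^ 2 = 2 * M * rp := by
    simp only [rp]
    linear_combination hs
  have hnum : rp ^ 2 - a ^ 2 = 2 * rp * (rp - M) := by
    linear_combination -hΔ
  rw [hΔ, hnum]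
  field_simp
end

section
/- For all (r, θ) with Σ ≠ 0, sin θ ≠ 0, and r² + a² ≠ 0, the Hartle–Hawking vector field ℓ is geodesic for the Kerr metric with inaffinity κ(r) = M(r² − a²)/(r² + a²)²: for every b ∈ Fin 4, Σ_a ℓ^a ( ∂_a ℓ^b + Σ_c Γ^b_{ac} ℓ^c ) = κ(r) ℓ^b, where Γ^a_{bc} = (1/2) Σ_d (g⁻¹)^{ad}(∂_b g_{dc} + ∂_c g_{bd} − ∂_d g_{bc}) are the Levi-Civita connection coefficients of the Kerr metric g. -/
open scoped BigOperators
open Matrix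

/-- The Kerr metric as a field on `ℝ⁴` in ingoing coordinates `x = (v, r, θ, φ)`. -/
noncomputable def kerrField (M a : ℝ) (x : Fin 4 → ℝ) : Matrix (Fin 4) (Fin 4) ℝ :=
  kerrMetric M a (x 1) (x 2)

/-- The Hartle–Hawking vector `ℓ` as a field on `ℝ⁴`. -/
noncomputable def ellField (M a : ℝ) (x : Fin 4 → ℝ) : Fin 4 → ℝ :=
  ellHH M a (x 1)

theorem pderiv4_eq_of_hasDerivAt_update {f : (Fin 4 → ℝ) → ℝ} {x : Fin 4 → ℝ} {i : Fin 4}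
    {f' : ℝ} (hf : DifferentiableAt ℝ f x)
    (h : HasDerivAt (fun t => f (Function.update x i t)) f' (x i)) :
    pderiv4 f x i = f' := by
  have hx : Function.update x i (x i) = x := Function.update_eq_self i x
  have hf' : HasFDerivAt f (fderiv ℝ f x) (Function.update x i (x i)) := by
    rw [hx]; exact hf.hasFDerivAt
  exact (hf'.comp_hasDerivAt (x i) (hasDerivAt_update x i (x i))).unique h

/-- Components of `∂g/∂r` for the Kerr metric `g`. -/
noncomputable def kerrMetricDerivR (M a r θ : ℝ) : Matrix (Fin 4) (Fin 4) ℝ :=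
  fun i j =>
    let e1 : Fin 4 → ℝ := ![1, 0, 0, -a * Real.sin θ ^ 2]
    let e3 : Fin 4 → ℝ := ![0, 0, 1, 0]
    let e4 : Fin 4 → ℝ := ![0, 0, 0, 1]
    2 * M * (kerrSigma a r θ - 2 * r ^ 2) / kerrSigma a r θ ^ 2 * e1 i * e1 j
      + 2 * r * e3 i * e3 j + 2 * r * Real.sin θ ^ 2 * e4 i * e4 j

/-- Components of `∂g/∂θ` for the Kerr metric `g`. -/
noncomputable def kerrMetricDerivθ (M a r θ : ℝ) : Matrix (Fin 4) (Fin 4) ℝ :=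
  fun i j =>
    let s := Real.sin θ
    let c := Real.cos θ
    let e1 : Fin 4 → ℝ := ![1, 0, 0, -a * s ^ 2]
    let e2 : Fin 4 → ℝ := ![0, 1, 0, -a * s ^ 2]
    let e3 : Fin 4 → ℝ := ![0, 0, 1, 0]
    let e4 : Fin 4 → ℝ := ![0, 0, 0, 1]
    let de : Fin 4 → ℝ := ![0, 0, 0, -2 * a * s * c]
    4 * M * r * a ^ 2 * s * c / kerrSigma a r θ ^ 2 * e1 i * e1 j
      - (1 - 2 * M * r / kerrSigma a r θ) * (de i * e1 j + e1 i * de j)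
      + (de i * e2 j + e1 i * de j + de i * e1 j + e2 i * de j)
      - 2 * a ^ 2 * s * c * e3 i * e3 j
      + (2 * s * c * kerrSigma a r θ - 2 * a ^ 2 * s ^ 3 * c) * e4 i * e4 j

theorem differentiableAt_kerrField {M a : ℝ} {x : Fin 4 → ℝ}
    (hSig : kerrSigma a (x 1) (x 2) ≠ 0) (i j : Fin 4) :
    DifferentiableAt ℝ (fun y => kerrField M a y i j) x := by
  unfold kerrField kerrMetric
  unfold kerrSigma at *
  fin_cases i <;> fin_cases j <;> simp <;> fun_prop (disch := assumption)

theorem hasDerivAt_kerrMetric_r {M a r θ : ℝ} (hSig : kerrSigma a r θ ≠ 0) (i j : Fin 4) :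
    HasDerivAt (fun t => kerrMetric M a t θ i j) (kerrMetricDerivR M a r θ i j) r := by
  have hS : HasDerivAt (fun t => kerrSigma a t θ) (2 * r) r := by
    simpa [kerrSigma] using (hasDerivAt_pow 2 r).add_const (a ^ 2 * Real.cos θ ^ 2)
  have hN : HasDerivAt (fun t : ℝ => 2 * M * t) (2 * M) r := by
    simpa using (hasDerivAt_id r).const_mul (2 * M)
  unfold kerrMetric kerrMetricDerivR
  extract_lets e1 e2 e3 e4
  refine (((((((hN.div hS hSig).const_sub 1).neg.mul_const (e1 i)).mul_const (e1 j)).add_const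
    (e1 i * e2 j + e2 i * e1 j)).add ((hS.mul_const (e3 i)).mul_const (e3 j))).add
    (((hS.mul_const (Real.sin θ ^ 2)).mul_const (e4 i)).mul_const (e4 j))).congr_deriv ?_
  ring

theorem hasDerivAt_kerrMetric_θ {M a r θ : ℝ} (hSig : kerrSigma a r θ ≠ 0) (i j : Fin 4) :
    HasDerivAt (fun t => kerrMetric M a r t i j) (kerrMetricDerivθ M a r θ i j) θ := by
  have hs2 : HasDerivAt (fun t => Real.sin t ^ 2) (2 * Real.sin θ * Real.cos θ) θ := by
    simpa using (Real.hasDerivAt_sin θ).fun_pow 2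
  have hS : HasDerivAt (fun t => kerrSigma a r t)
      (-2 * a ^ 2 * Real.sin θ * Real.cos θ) θ := by
    unfold kerrSigma
    refine ((((Real.hasDerivAt_cos θ).fun_pow 2).const_mul (a ^ 2)).const_add
      (r ^ 2)).congr_deriv ?_
    push_cast
    ring
  have hd : HasDerivAt (fun t => -a * Real.sin t ^ 2) (-2 * a * Real.sin θ * Real.cos θ) θ :=
    (hs2.const_mul (-a)).congr_deriv (by ring)
  have he (u v : ℝ) (k : Fin 4) : HasDerivAt
      (fun t => (![u, v, 0, -a * Real.sin t ^ 2] : Fin 4 → ℝ) k)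
      ((![0, 0, 0, -2 * a * Real.sin θ * Real.cos θ] : Fin 4 → ℝ) k) θ := by
    fin_cases k
    · exact hasDerivAt_const θ u
    · exact hasDerivAt_const θ v
    · exact hasDerivAt_const θ 0
    · exact hd
  have hQ := (((hasDerivAt_const θ (2 * M * r)).div hS hSig).const_sub 1).neg
  unfold kerrMetric kerrMetricDerivθ
  refine (((((hQ.mul (he 1 0 i)).mul (he 1 0 j)).add
    (((he 1 0 i).mul (he 0 1 j)).add ((he 0 1 i).mul (he 1 0 j)))).add
    ((hS.mul_const ((![0, 0, 1, 0] : Fin 4 → ℝ) i)).mul_const ((![0, 0, 1, 0] : Fin 4 → ℝ) j))).add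
    (((hS.mul hs2).mul_const ((![0, 0, 0, 1] : Fin 4 → ℝ) i)).mul_const
      ((![0, 0, 0, 1] : Fin 4 → ℝ) j))).congr_deriv ?_
  simp only [Pi.mul_apply, Pi.neg_apply, Pi.div_apply]
  ring

theorem pderiv4_kerrField {M a : ℝ} {x : Fin 4 → ℝ}
    (hSig : kerrSigma a (x 1) (x 2) ≠ 0) (i j k : Fin 4) :
    pderiv4 (fun y => kerrField M a y i j) x k =
      (![0, kerrMetricDerivR M a (x 1) (x 2) i j,
        kerrMetricDerivθ M a (x 1) (x 2) i j, 0] : Fin 4 → ℝ) k := by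
  refine pderiv4_eq_of_hasDerivAt_update (differentiableAt_kerrField hSig i j) ?_
  fin_cases k
  · simpa [kerrField] using hasDerivAt_const (x 0) (kerrMetric M a (x 1) (x 2) i j)
  · simpa [kerrField] using hasDerivAt_kerrMetric_r hSig i j
  · simpa [kerrField] using hasDerivAt_kerrMetric_θ hSig i j
  · simpa [kerrField] using hasDerivAt_const (x 3) (kerrMetric M a (x 1) (x 2) i j)

theorem pderiv4_ellField {M a : ℝ} {x : Fin 4 → ℝ} (hra : x 1 ^ 2 + a ^ 2 ≠ 0) (b k : Fin 4) :
    pderiv4 (fun y => ellField M a y b) x k =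
      if k = 1 then
        (![0, M * (x 1 ^ 2 - a ^ 2) / (x 1 ^ 2 + a ^ 2) ^ 2, 0,
          -2 * a * x 1 / (x 1 ^ 2 + a ^ 2) ^ 2] : Fin 4 → ℝ) b
      else 0 := by
  have hR : HasDerivAt (fun t : ℝ => t ^ 2 + a ^ 2) (2 * x 1) (x 1) := by
    simpa using (hasDerivAt_pow 2 (x 1)).add_const (a ^ 2)
  have hN : HasDerivAt (fun t => kerrΔ M a t) (2 * x 1 - 2 * M) (x 1) := by
    simpa [kerrΔ] using ((hasDerivAt_pow 2 (x 1)).sub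
      ((hasDerivAt_id (x 1)).const_mul (2 * M))).add_const (a ^ 2)
  have hell : HasDerivAt (fun t => ellHH M a t b)
      ((![0, M * (x 1 ^ 2 - a ^ 2) / (x 1 ^ 2 + a ^ 2) ^ 2, 0,
          -2 * a * x 1 / (x 1 ^ 2 + a ^ 2) ^ 2] : Fin 4 → ℝ) b) (x 1) := by
    unfold ellHH
    fin_cases b
    · exact hasDerivAt_const _ _
    · refine (hN.div (hR.const_mul 2) (mul_ne_zero two_ne_zero hra)).congr_deriv ?_
      simp [kerrΔ]
      field_simp
      ring
    · exact hasDerivAt_const _ _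
    · refine ((hasDerivAt_const (x 1) a).div hR hra).congr_deriv ?_
      simp
      ring
  have hdiff : DifferentiableAt ℝ (fun y => ellField M a y b) x :=
    hell.differentiableAt.comp (f := fun y : Fin 4 → ℝ => y 1) x (differentiableAt_apply 1 x)
  refine pderiv4_eq_of_hasDerivAt_update hdiff ?_
  split_ifs with hk
  · subst hk
    simpa [ellField] using hell
  · simpa [ellField, Function.update_of_ne (Ne.symm hk)] using
      hasDerivAt_const (x k) (ellHH M a (x 1) b)

theorem det_kerrMetric {M a r θ : ℝ} :
    (kerrMetric M a r θ).det = -(kerrSigma a r θ ^ 2 * Real.sin θ ^ 2) := by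
  simp [Matrix.det_succ_row_zero, Fin.sum_univ_succ, kerrMetric, Fin.succAbove]
  ring

/-- The lowered-index form of the geodesic equation, with `∂g` written out explicitly. -/
theorem ellHH_geodesic_lowered {M a r θ : ℝ} (hSig : kerrSigma a r θ ≠ 0)
    (hra : r ^ 2 + a ^ 2 ≠ 0) (d : Fin 4) :
    ∑ i, ∑ c, ellHH M a r i * ellHH M a r c * (1 / 2 *
      ((![0, kerrMetricDerivR M a r θ d c, kerrMetricDerivθ M a r θ d c, 0] : Fin 4 → ℝ) i
      + (![0, kerrMetricDerivR M a r θ i d, kerrMetricDerivθ M a r θ i d, 0] : Fin 4 → ℝ) c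
      - (![0, kerrMetricDerivR M a r θ i c, kerrMetricDerivθ M a r θ i c, 0] : Fin 4 → ℝ) d)) =
    ∑ b, kerrMetric M a r θ d b * (M * (r ^ 2 - a ^ 2) / (r ^ 2 + a ^ 2) ^ 2 * ellHH M a r b
      - ellHH M a r 1 * (![0, M * (r ^ 2 - a ^ 2) / (r ^ 2 + a ^ 2) ^ 2, 0,
          -2 * a * r / (r ^ 2 + a ^ 2) ^ 2] : Fin 4 → ℝ) b) := by
  have hS : kerrSigma a r θ = r ^ 2 + a ^ 2 * (1 - Real.sin θ ^ 2) := by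
    rw [kerrSigma, Real.cos_sq']
  fin_cases d <;>
    simp [Fin.sum_univ_four, ellHH, kerrΔ, kerrMetric, kerrMetricDerivR, kerrMetricDerivθ] <;>
    generalize kerrSigma a r θ = S at hSig hS ⊢ <;>
    field_simp <;> rw [hS] <;> ring

/-- Wherever `Σ ≠ 0`, `sin θ ≠ 0`, and `r² + a² ≠ 0`, the
Hartle–Hawking vector field `ℓ` is geodesic for the Kerr metric with inaffinity
`κ(r) = M(r² − a²)/(r² + a²)²`:  for every `b`,
`Σ_a ℓ^a (∂_a ℓ^b + Σ_c Γ^b_{ac} ℓ^c) = κ(r) ℓ^b`, with `Γ` the Levi-Civita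
connection coefficients of the Kerr metric. -/
theorem ellHH_geodesic_with_inaffinity (M a : ℝ) (x : Fin 4 → ℝ)
    (hSig : kerrSigma a (x 1) (x 2) ≠ 0) (hs : Real.sin (x 2) ≠ 0)
    (hra : (x 1) ^ 2 + a ^ 2 ≠ 0) :
    ∀ b : Fin 4,
      ∑ i, ellField M a x i *
          (pderiv4 (fun y => ellField M a y b) x i
            + ∑ c, Christoffel (kerrField M a) x b i c * ellField M a x c)
      = M * ((x 1) ^ 2 - a ^ 2) / ((x 1) ^ 2 + a ^ 2) ^ 2 * ellField M a x b := by
  have hlow := ellHH_geodesic_lowered (M := M) hSig hra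
  let V : Fin 4 → ℝ := fun b =>
    M * (x 1 ^ 2 - a ^ 2) / (x 1 ^ 2 + a ^ 2) ^ 2 * ellHH M a (x 1) b
      - ellHH M a (x 1) 1 * (![0, M * (x 1 ^ 2 - a ^ 2) / (x 1 ^ 2 + a ^ 2) ^ 2, 0,
          -2 * a * x 1 / (x 1 ^ 2 + a ^ 2) ^ 2] : Fin 4 → ℝ) b
  have hdet : IsUnit (kerrField M a x).det := by
    rw [kerrField, det_kerrMetric, isUnit_iff_ne_zero]
    exact neg_ne_zero.2 (mul_ne_zero (pow_ne_zero 2 hSig) (pow_ne_zero 2 hs))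
  intro b
  have hinv : ∑ d, (kerrField M a x)⁻¹ b d * ∑ e, kerrField M a x d e * V e = V b := by
    have h : (kerrField M a x)⁻¹ *ᵥ (kerrField M a x *ᵥ V) = V := by
      rw [Matrix.mulVec_mulVec, Matrix.nonsing_inv_mul _ hdet, Matrix.one_mulVec]
    exact congrFun h b
  have hΓ : ∑ i, ellField M a x i * ∑ c, Christoffel (kerrField M a) x b i c * ellField M a x c
      = V b := by
    have hlow' (d : Fin 4) : ∑ e, kerrField M a x d e * V e = _ := (hlow d).symm
    simp only [← hinv, hlow', Christoffel, pderiv4_kerrField hSig, ellField, Finset.mul_sum,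
      Finset.sum_mul]
    rw [Finset.sum_comm_cycle]
    refine Finset.sum_congr rfl fun d _ => Finset.sum_congr rfl fun i _ =>
      Finset.sum_congr rfl fun c _ => ?_
    ring
  simp only [mul_add, Finset.sum_add_distrib, hΓ, pderiv4_ellField hra]
  simp [V, ellField]
end
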